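/- arXiv:2103.00665 — 2 statements merged into one kernel-verified Lean document; each statement's English description precedes it below -/
import Mathlib

section
/- Let 𝔤 be a Lie superalgebra and 𝔥 = π'(gr'(T'(𝔤))) be the parity-changed split Takiff superalgebra, with weights 0, α, β, α+β where α, β are both odd. Define 𝔭₀ := 𝔤₀, 𝔭₁ := {Y + dY | Y ∈ 𝔤₁} ⊂ 𝔥_α ⊕ 𝔥_β, and 𝔭₂ := 𝔥_{α+β} = d𝔤₀. Then 𝔭 = 𝔭₀ ⊕ 𝔭₁ ⊕ 𝔭₂ is a ℤ-graded Lie subsuperalgebra of 𝔥 with [𝔭_i, 𝔭_j] ⊆ 𝔭_{i+j}; in particular, for Y₁, Y₂ ∈ 𝔤₁, [Y₁ + dY₁, Y₂ + dY₂] = 2·d([Y₁,Y₂]) ∈ 𝔭₂. -/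
/-- A Lie superalgebra over `K`, presented by its even part `g0`, its odd part `g1`,
and the four components of the bracket:
`b00 : [·,·] : 𝔤₀×𝔤₀ → 𝔤₀`, `b01 : 𝔤₀×𝔤₁ → 𝔤₁`, `b10 : 𝔤₁×𝔤₀ → 𝔤₁`, `b11 : 𝔤₁×𝔤₁ → 𝔤₀`.
The axioms are bilinearity, super skew-symmetry `[x,y] = -(-1)^{|x||y|}[y,x]`, and the
super Jacobi identity `[x,[y,z]] - (-1)^{|x||y|}[y,[x,z]] = [[x,y],z]`, written out in
all homogeneous components. -/
structure IsLieSuperAlg (K : Type*) [Field K]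
    {g0 g1 : Type*} [AddCommGroup g0] [Module K g0] [AddCommGroup g1] [Module K g1]
    (b00 : g0 → g0 → g0) (b01 : g0 → g1 → g1)
    (b10 : g1 → g0 → g1) (b11 : g1 → g1 → g0) : Prop where
  b00_addl : ∀ x x' y, b00 (x + x') y = b00 x y + b00 x' y
  b00_smull : ∀ (c : K) x y, b00 (c • x) y = c • b00 x y
  b00_addr : ∀ x y y', b00 x (y + y') = b00 x y + b00 x y'
  b00_smulr : ∀ (c : K) x y, b00 x (c • y) = c • b00 x y
  b01_addl : ∀ x x' y, b01 (x + x') y = b01 x y + b01 x' y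
  b01_smull : ∀ (c : K) x y, b01 (c • x) y = c • b01 x y
  b01_addr : ∀ x y y', b01 x (y + y') = b01 x y + b01 x y'
  b01_smulr : ∀ (c : K) x y, b01 x (c • y) = c • b01 x y
  b10_addl : ∀ x x' y, b10 (x + x') y = b10 x y + b10 x' y
  b10_smull : ∀ (c : K) x y, b10 (c • x) y = c • b10 x y
  b10_addr : ∀ x y y', b10 x (y + y') = b10 x y + b10 x y'
  b10_smulr : ∀ (c : K) x y, b10 x (c • y) = c • b10 x y
  b11_addl : ∀ x x' y, b11 (x + x') y = b11 x y + b11 x' y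
  b11_smull : ∀ (c : K) x y, b11 (c • x) y = c • b11 x y
  b11_addr : ∀ x y y', b11 x (y + y') = b11 x y + b11 x y'
  b11_smulr : ∀ (c : K) x y, b11 x (c • y) = c • b11 x y
  skew00 : ∀ x y, b00 x y = - b00 y x
  skew01 : ∀ x y, b01 x y = - b10 y x
  skew11 : ∀ x y, b11 x y = b11 y x
  jac000 : ∀ x y z, b00 x (b00 y z) - b00 y (b00 x z) = b00 (b00 x y) z
  jac001 : ∀ x y z, b01 x (b01 y z) - b01 y (b01 x z) = b01 (b00 x y) z
  jac010 : ∀ x y z, b01 x (b10 y z) - b10 y (b00 x z) = b10 (b01 x y) z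
  jac011 : ∀ x y z, b00 x (b11 y z) - b11 y (b01 x z) = b11 (b01 x y) z
  jac100 : ∀ x y z, b10 x (b00 y z) - b01 y (b10 x z) = b10 (b10 x y) z
  jac101 : ∀ x y z, b11 x (b01 y z) - b00 y (b11 x z) = b11 (b10 x y) z
  jac110 : ∀ x y z, b11 x (b10 y z) + b11 y (b10 x z) = b00 (b11 x y) z
  jac111 : ∀ x y z, b10 x (b11 y z) + b10 y (b11 x z) = b01 (b11 x y) z

namespace Stmt6

variable {K : Type*} [Field K]
variable {g0 g1 : Type*} [AddCommGroup g0] [Module K g0] [AddCommGroup g1] [Module K g1]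
variable (b00 : g0 → g0 → g0) (b01 : g0 → g1 → g1) (b10 : g1 → g0 → g1) (b11 : g1 → g1 → g0)

/- `𝔥 = π'(gr'(T'(𝔤)))`: carrier `𝔤 ⊕ d𝔤` with even part `𝔤₀ ⊕ d𝔤₀ = g0 × g0`
(an element `(x, z)` stands for `x + d(z)`) and odd part `𝔤₁ ⊕ d𝔤₁ = g1 × g1`
(an element `(ξ, u)` stands for `ξ + d(u)`).  Bracket: the bracket of `𝔤` on `𝔤₀` with `𝔤`,
`[X, dY] = d([X,Y])` for `X ∈ 𝔤₀`, `[Y, dY'] = d([Y,Y']) = [dY, Y']` for `Y, Y' ∈ 𝔤₁`,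
`[𝔤₁,𝔤₁] = 0`, `[d𝔤,d𝔤] = 0`. -/
def hb00 : g0 × g0 → g0 × g0 → g0 × g0 :=
  fun p q => (b00 p.1 q.1, b00 p.1 q.2 - b00 q.1 p.2)
def hb01 : g0 × g0 → g1 × g1 → g1 × g1 :=
  fun p q => (b01 p.1 q.1, b01 p.1 q.2)
def hb10 : g1 × g1 → g0 × g0 → g1 × g1 :=
  fun p q => (b10 p.1 q.1, b10 p.2 q.1)
def hb11 : g1 × g1 → g1 × g1 → g0 × g0 :=
  fun p q => (0, b11 p.1 q.2 + b11 q.1 p.2)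

/-- `𝔭₀ = 𝔤₀ ⊂ 𝔥₀`, `𝔭₂ = d𝔤₀ = 𝔥_{α+β}`, all other even weights `0`. -/
def pEven : ℤ → Submodule K (g0 × g0) :=
  fun n =>
    if n = 0 then (⊤ : Submodule K g0).prod (⊥ : Submodule K g0)
    else if n = 2 then (⊥ : Submodule K g0).prod (⊤ : Submodule K g0)
    else ⊥

/-- `𝔭₁ = {Y + dY | Y ∈ 𝔤₁} ⊂ 𝔥_α ⊕ 𝔥_β`, all other odd weights `0`. -/
def pOdd : ℤ → Submodule K (g1 × g1) :=
  fun n =>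
    if n = 1 then LinearMap.range ((LinearMap.id : g1 →ₗ[K] g1).prod LinearMap.id)
    else ⊥

theorem mem_pEven_iff (n : ℤ) (v : g0 × g0) :
    v ∈ pEven (K := K) (g0 := g0) n ↔
      (n = 0 ∧ v.2 = 0) ∨ (n = 2 ∧ v.1 = 0) ∨ v = 0 := by
  unfold pEven
  obtain ⟨a, b⟩ := v
  split_ifs with h1 h2
  · subst h1; simp [Submodule.mem_prod]
  · subst h2; simp [Submodule.mem_prod] <;> tauto
  · simp [h1, h2]

theorem mem_pOdd_iff (n : ℤ) (v : g1 × g1) :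
    v ∈ pOdd (K := K) (g1 := g1) n ↔ (n = 1 ∧ v.1 = v.2) ∨ v = 0 := by
  unfold pOdd
  obtain ⟨a, b⟩ := v
  split_ifs with h1
  · subst h1
    simp only [LinearMap.mem_range, LinearMap.prod_apply, Function.prod, LinearMap.id_apply,
      Prod.mk.injEq, Prod.mk_eq_zero]
    constructor
    · rintro ⟨y, rfl, rfl⟩; simp
    · rintro (⟨-, h⟩ | ⟨rfl, rfl⟩)
      · exact ⟨a, rfl, h⟩
      · exact ⟨0, rfl, rfl⟩
  · simp [h1]

/-- `𝔭 = 𝔭₀ ⊕ 𝔭₁ ⊕ 𝔭₂` with `𝔭₀ = 𝔤₀`, `𝔭₁ = {Y + dY | Y ∈ 𝔤₁}`,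
`𝔭₂ = d𝔤₀` is a ℤ-graded Lie subsuperalgebra of `𝔥 = π'(gr'(T'(𝔤)))`:
`[𝔭_i, 𝔭_j] ⊆ 𝔭_{i+j}` for all `i, j`; in particular for `Y₁, Y₂ ∈ 𝔤₁`,
`[Y₁ + dY₁, Y₂ + dY₂] = 2 • d([Y₁,Y₂]) ∈ 𝔭₂`. -/
theorem diag_graded_subalgebra (h : IsLieSuperAlg K b00 b01 b10 b11) :
    (∀ i j : ℤ, ∀ v ∈ pEven (K := K) (g0 := g0) i, ∀ w ∈ pEven (K := K) (g0 := g0) j,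
        hb00 b00 v w ∈ pEven (K := K) (g0 := g0) (i + j)) ∧
    (∀ i j : ℤ, ∀ v ∈ pEven (K := K) (g0 := g0) i, ∀ w ∈ pOdd (K := K) (g1 := g1) j,
        hb01 b01 v w ∈ pOdd (K := K) (g1 := g1) (i + j)) ∧
    (∀ i j : ℤ, ∀ v ∈ pOdd (K := K) (g1 := g1) i, ∀ w ∈ pEven (K := K) (g0 := g0) j,
        hb10 b10 v w ∈ pOdd (K := K) (g1 := g1) (i + j)) ∧
    (∀ i j : ℤ, ∀ v ∈ pOdd (K := K) (g1 := g1) i, ∀ w ∈ pOdd (K := K) (g1 := g1) j,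
        hb11 b11 v w ∈ pEven (K := K) (g0 := g0) (i + j)) ∧
    (∀ Y₁ Y₂ : g1, hb11 b11 (Y₁, Y₁) (Y₂, Y₂) = (2 : K) • ((0 : g0), b11 Y₁ Y₂)) := by
  have z00l : ∀ y, b00 0 y = 0 := fun y => by simpa using h.b00_smull 0 0 y
  have z00r : ∀ x, b00 x 0 = 0 := fun x => by simpa using h.b00_smulr 0 x 0
  have z01l : ∀ y, b01 0 y = 0 := fun y => by simpa using h.b01_smull 0 0 y
  have z01r : ∀ x, b01 x 0 = 0 := fun x => by simpa using h.b01_smulr 0 x 0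
  have z10l : ∀ y, b10 0 y = 0 := fun y => by simpa using h.b10_smull 0 0 y
  have z10r : ∀ x, b10 x 0 = 0 := fun x => by simpa using h.b10_smulr 0 x 0
  have z11l : ∀ y, b11 0 y = 0 := fun y => by simpa using h.b11_smull 0 0 y
  have z11r : ∀ x, b11 x 0 = 0 := fun x => by simpa using h.b11_smulr 0 x 0
  refine ⟨?_, ?_, ?_, ?_, ?_⟩
  · rintro i j ⟨a, b⟩ hv ⟨c, d⟩ hw
    rw [mem_pEven_iff] at hv hw ⊢
    simp only [Prod.mk_eq_zero] at hv hw
    rcases hv with ⟨rfl, rfl⟩ | ⟨rfl, rfl⟩ | ⟨rfl, rfl⟩ <;>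
    rcases hw with ⟨rfl, rfl⟩ | ⟨rfl, rfl⟩ | ⟨rfl, rfl⟩ <;>
    simp [hb00, z00l, z00r]
  · rintro i j ⟨a, b⟩ hv ⟨c, d⟩ hw
    rw [mem_pEven_iff] at hv
    rw [mem_pOdd_iff] at hw ⊢
    simp only [Prod.mk_eq_zero] at hv hw
    rcases hv with ⟨rfl, rfl⟩ | ⟨rfl, rfl⟩ | ⟨rfl, rfl⟩ <;>
    rcases hw with ⟨rfl, rfl⟩ | ⟨rfl, rfl⟩ <;>
    simp [hb01, z01l, z01r]
  · rintro i j ⟨a, b⟩ hv ⟨c, d⟩ hw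
    rw [mem_pEven_iff] at hw
    rw [mem_pOdd_iff] at hv ⊢
    simp only [Prod.mk_eq_zero] at hv hw
    rcases hv with ⟨rfl, rfl⟩ | ⟨rfl, rfl⟩ <;>
    rcases hw with ⟨rfl, rfl⟩ | ⟨rfl, rfl⟩ | ⟨rfl, rfl⟩ <;>
    simp [hb10, z10l, z10r]
  · rintro i j ⟨a, b⟩ hv ⟨c, d⟩ hw
    rw [mem_pOdd_iff] at hv hw
    rw [mem_pEven_iff]
    simp only [Prod.mk_eq_zero] at hv hw
    rcases hv with ⟨rfl, rfl⟩ | ⟨rfl, rfl⟩ <;>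
    rcases hw with ⟨rfl, rfl⟩ | ⟨rfl, rfl⟩ <;>
    simp [hb11, z11l, z11r]
  · intro Y₁ Y₂
    simp [hb11, h.skew11 Y₂ Y₁, two_smul]

end Stmt6
end

section
/- Let 𝔤 be a Lie superalgebra. Define 𝔥 = π'(gr'(T'^∞(𝔤))) to be the vector space ⊕_{p≥0} ⊕_{i₁<...<i_p} d_{i₁}···d_{i_p}(𝔤) where now all d_i are declared even (so d_I(X) has parity |X|), with bracket given by the rules: (1) [d_I(𝔤), d_J(𝔤)] = 0 if I ∩ J ≠ ∅; (2) [d_I(𝔤_ī), d_J(𝔤_j̄)] = 0 if both #I + ī and #J + j̄ are odd (cardinalities mod 2); (3) otherwise [d_I X, d_J Y] = d_{I∪J}([X,Y]). Then 𝔥 is a Lie superalgebra. -/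
/-- The sign `(-1)^{ij}` for parities `i j : ℤ₂`, as an element of `K`. -/
def ssign (K : Type*) [Field K] (i j : ZMod 2) : K := if i = 1 ∧ j = 1 then -1 else 1

/-- A Lie superalgebra structure on a single carrier `L`: a ℤ₂-grading `p` by submodules
whose internal direct sum is `L`, and a bilinear bracket `br` which is graded and
satisfies super skew-symmetry and the super Jacobi identity on homogeneous elements. -/
structure IsLieSuperOn (K : Type*) [Field K] {L : Type*} [AddCommGroup L] [Module K L]
    (p : ZMod 2 → Submodule K L) (br : L → L → L) : Prop where
  add_left : ∀ x x' y, br (x + x') y = br x y + br x' y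
  smul_left : ∀ (c : K) x y, br (c • x) y = c • br x y
  add_right : ∀ x y y', br x (y + y') = br x y + br x y'
  smul_right : ∀ (c : K) x y, br x (c • y) = c • br x y
  internal : DirectSum.IsInternal p
  grade : ∀ i j, ∀ x ∈ p i, ∀ y ∈ p j, br x y ∈ p (i + j)
  skew : ∀ i j, ∀ x ∈ p i, ∀ y ∈ p j, br x y = - ssign K i j • br y x
  jacobi : ∀ i j, ∀ x ∈ p i, ∀ y ∈ p j, ∀ z,
    br x (br y z) - ssign K i j • br y (br x z) = br (br x y) z

namespace Stmt9

variable {K : Type*} [Field K]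
variable {g0 g1 : Type*} [AddCommGroup g0] [Module K g0] [AddCommGroup g1] [Module K g1]
variable (b00 : g0 → g0 → g0) (b01 : g0 → g1 → g1) (b10 : g1 → g0 → g1) (b11 : g1 → g1 → g0)

/- The carrier of `𝔥 = π'(gr'(T'^∞(𝔤)))`: the component indexed by a finite set
`I = {i₁ < … < i_p} ⊆ ℕ` is `d_{i₁}⋯d_{i_p}(𝔤) ≅ 𝔤 = g0 × g1`; after the parity change
`π'` all `d_i` are even, so the element `d_I(X)` has parity `|X|`. -/

/-- The component of the bracket of `𝔥` pairing `d_I(𝔤)` with `d_J(𝔤)` for disjoint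
`I, J`, implementing the rules:
(2) `[d_I(𝔤_ī), d_J(𝔤_j̄)] = 0` if `#I + ī` and `#J + j̄` are both odd;
(3) otherwise `[d_I X, d_J Y] = d_{I∪J}([X,Y])`. -/
def hComp (I J : Finset ℕ) : (g0 × g1) → (g0 × g1) → (g0 × g1) :=
  fun v w =>
    ((if I.card % 2 = 1 ∧ J.card % 2 = 1 then 0 else b00 v.1 w.1) +
       (if I.card % 2 = 0 ∧ J.card % 2 = 0 then 0 else b11 v.2 w.2),
     (if I.card % 2 = 1 ∧ J.card % 2 = 0 then 0 else b01 v.1 w.2) +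
       (if I.card % 2 = 0 ∧ J.card % 2 = 1 then 0 else b10 v.2 w.1))

/-- The bracket of `𝔥`: rule (1) `[d_I(𝔤), d_J(𝔤)] = 0` for `I ∩ J ≠ ∅` is implemented by
summing only over decompositions of the index set `S` into disjoint pairs `(I, S \ I)`. -/
def hBr : (∀ _ : Finset ℕ, g0 × g1) → (∀ _ : Finset ℕ, g0 × g1) →
    (∀ _ : Finset ℕ, g0 × g1) :=
  fun f g S => ∑ I ∈ S.powerset, hComp b00 b01 b10 b11 I (S \ I) (f I) (g (S \ I))

/-- After `π'`, `d_I(X)` has parity `|X|`: the even part consists of the elements with all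
`g1`-components zero, the odd part of those with all `g0`-components zero. -/
def hPar (i : ZMod 2) : Submodule K (∀ _ : Finset ℕ, g0 × g1) :=
  if i = 0 then
    LinearMap.ker (LinearMap.pi fun I : Finset ℕ =>
      (LinearMap.snd K g0 g1).comp (LinearMap.proj I))
  else
    LinearMap.ker (LinearMap.pi fun I : Finset ℕ =>
      (LinearMap.fst K g0 g1).comp (LinearMap.proj I))

section helpers
variable {b00 b01 b10 b11}

lemma mem_hPar_zero (f : Finset ℕ → g0 × g1) :
    f ∈ hPar (K := K) (g0 := g0) (g1 := g1) 0 ↔ ∀ I, (f I).2 = 0 := by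
  simp [hPar, funext_iff]

lemma mem_hPar_one (f : Finset ℕ → g0 × g1) :
    f ∈ hPar (K := K) (g0 := g0) (g1 := g1) 1 ↔ ∀ I, (f I).1 = 0 := by
  simp [hPar, funext_iff]

lemma zmod_cases (i : ZMod 2) : i = 0 ∨ i = 1 := by
  revert i; decide

lemma hComp_add_left (h : IsLieSuperAlg K b00 b01 b10 b11) (I J : Finset ℕ) (v v' w : g0 × g1) :
    hComp b00 b01 b10 b11 I J (v + v') w =
      hComp b00 b01 b10 b11 I J v w + hComp b00 b01 b10 b11 I J v' w := by
  simp only [hComp, Prod.fst_add, Prod.snd_add, h.b00_addl, h.b01_addl, h.b10_addl, h.b11_addl,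
    Prod.mk_add_mk]
  ext <;> dsimp only <;> split_ifs <;> abel

lemma hComp_add_right (h : IsLieSuperAlg K b00 b01 b10 b11) (I J : Finset ℕ) (v w w' : g0 × g1) :
    hComp b00 b01 b10 b11 I J v (w + w') =
      hComp b00 b01 b10 b11 I J v w + hComp b00 b01 b10 b11 I J v w' := by
  simp only [hComp, Prod.fst_add, Prod.snd_add, h.b00_addr, h.b01_addr, h.b10_addr, h.b11_addr,
    Prod.mk_add_mk]
  ext <;> dsimp only <;> split_ifs <;> abel

lemma hComp_smul_left (h : IsLieSuperAlg K b00 b01 b10 b11) (I J : Finset ℕ) (c : K)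
    (v w : g0 × g1) :
    hComp b00 b01 b10 b11 I J (c • v) w = c • hComp b00 b01 b10 b11 I J v w := by
  simp only [hComp, Prod.smul_fst, Prod.smul_snd, h.b00_smull, h.b01_smull, h.b10_smull,
    h.b11_smull, Prod.smul_mk, smul_add, smul_ite, smul_zero]

lemma hComp_smul_right (h : IsLieSuperAlg K b00 b01 b10 b11) (I J : Finset ℕ) (c : K)
    (v w : g0 × g1) :
    hComp b00 b01 b10 b11 I J v (c • w) = c • hComp b00 b01 b10 b11 I J v w := by
  simp only [hComp, Prod.smul_fst, Prod.smul_snd, h.b00_smulr, h.b01_smulr, h.b10_smulr,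
    h.b11_smulr, Prod.smul_mk, smul_add, smul_ite, smul_zero]

lemma hComp_sum_left (h : IsLieSuperAlg K b00 b01 b10 b11) (I J : Finset ℕ) {ι : Type*}
    (s : Finset ι) (F : ι → g0 × g1) (w : g0 × g1) :
    hComp b00 b01 b10 b11 I J (∑ i ∈ s, F i) w =
      ∑ i ∈ s, hComp b00 b01 b10 b11 I J (F i) w :=
  map_sum (AddMonoidHom.mk' (fun v => hComp b00 b01 b10 b11 I J v w)
    (fun v v' => hComp_add_left h I J v v' w)) F s

lemma hComp_sum_right (h : IsLieSuperAlg K b00 b01 b10 b11) (I J : Finset ℕ) {ι : Type*}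
    (s : Finset ι) (F : ι → g0 × g1) (v : g0 × g1) :
    hComp b00 b01 b10 b11 I J v (∑ i ∈ s, F i) =
      ∑ i ∈ s, hComp b00 b01 b10 b11 I J v (F i) :=
  map_sum (AddMonoidHom.mk' (fun w => hComp b00 b01 b10 b11 I J v w)
    (fun w w' => hComp_add_right h I J v w w')) F s

/-- `v` is homogeneous of parity `i` in `𝔤`. -/
def IsHomog (i : ZMod 2) (v : g0 × g1) : Prop := if i = 0 then v.2 = 0 else v.1 = 0

lemma mem_hPar (i : ZMod 2) (f : Finset ℕ → g0 × g1) :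
    f ∈ hPar (K := K) (g0 := g0) (g1 := g1) i ↔ ∀ I, IsHomog i (f I) := by
  rcases zmod_cases i with rfl | rfl
  · simp [mem_hPar_zero, IsHomog]
  · simp [mem_hPar_one, IsHomog]

lemma z00l (h : IsLieSuperAlg K b00 b01 b10 b11) (x : g0) : b00 0 x = 0 := by
  simpa using h.b00_addl 0 0 x

lemma z00r (h : IsLieSuperAlg K b00 b01 b10 b11) (x : g0) : b00 x 0 = 0 := by
  simpa using h.b00_addr x 0 0

lemma z01l (h : IsLieSuperAlg K b00 b01 b10 b11) (x : g1) : b01 0 x = 0 := by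
  simpa using h.b01_addl 0 0 x

lemma z01r (h : IsLieSuperAlg K b00 b01 b10 b11) (x : g0) : b01 x 0 = 0 := by
  simpa using h.b01_addr x 0 0

lemma z10l (h : IsLieSuperAlg K b00 b01 b10 b11) (x : g0) : b10 0 x = 0 := by
  simpa using h.b10_addl 0 0 x

lemma z10r (h : IsLieSuperAlg K b00 b01 b10 b11) (x : g1) : b10 x 0 = 0 := by
  simpa using h.b10_addr x 0 0

lemma z11l (h : IsLieSuperAlg K b00 b01 b10 b11) (x : g1) : b11 0 x = 0 := by
  simpa using h.b11_addl 0 0 x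

lemma z11r (h : IsLieSuperAlg K b00 b01 b10 b11) (x : g1) : b11 x 0 = 0 := by
  simpa using h.b11_addr x 0 0

lemma hComp_grade (h : IsLieSuperAlg K b00 b01 b10 b11) (i j : ZMod 2) (I J : Finset ℕ)
    (v w : g0 × g1) (hv : IsHomog i v) (hw : IsHomog j w) :
    IsHomog (i + j) (hComp b00 b01 b10 b11 I J v w) := by
  obtain ⟨v0, v1⟩ := v
  obtain ⟨w0, w1⟩ := w
  have e : (1 + 1 : ZMod 2) = 0 := by decide
  rcases zmod_cases i with rfl | rfl <;> rcases zmod_cases j with rfl | rfl <;>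
    simp [IsHomog] at hv hw <;> subst hv hw <;>
    simp [IsHomog, hComp, e, z00l h, z00r h, z01l h, z01r h, z10l h, z10r h, z11l h, z11r h]

lemma hComp_skew (h : IsLieSuperAlg K b00 b01 b10 b11) (i j : ZMod 2) (I J : Finset ℕ)
    (v w : g0 × g1) (hv : IsHomog i v) (hw : IsHomog j w) :
    hComp b00 b01 b10 b11 I J v w = - ssign K i j • hComp b00 b01 b10 b11 J I w v := by
  obtain ⟨v0, v1⟩ := v
  obtain ⟨w0, w1⟩ := w
  have s00 := h.skew00 v0 w0
  have s11 := h.skew11 v1 w1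
  rcases zmod_cases i with rfl | rfl <;> rcases zmod_cases j with rfl | rfl <;>
    simp [IsHomog] at hv hw <;> subst hv hw <;>
    rcases Nat.mod_two_eq_zero_or_one I.card with hI | hI <;>
    rcases Nat.mod_two_eq_zero_or_one J.card with hJ | hJ <;>
    simp [hComp, ssign, hI, hJ, z00l h, z00r h, z01l h, z01r h, z10l h, z10r h, z11l h, z11r h,
      s00, h.skew01, s11]

lemma hComp_jacobi (h : IsLieSuperAlg K b00 b01 b10 b11) (i j : ZMod 2)
    (I J L IJ IL JL : Finset ℕ) (hIJ : IJ.card = I.card + J.card)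
    (hIL : IL.card = I.card + L.card) (hJL : JL.card = J.card + L.card)
    (x y z : g0 × g1) (hx : IsHomog i x) (hy : IsHomog j y) :
    hComp b00 b01 b10 b11 I JL x (hComp b00 b01 b10 b11 J L y z) -
      ssign K i j • hComp b00 b01 b10 b11 J IL y (hComp b00 b01 b10 b11 I L x z) =
      hComp b00 b01 b10 b11 IJ L (hComp b00 b01 b10 b11 I J x y) z := by
  obtain ⟨x0, x1⟩ := x
  obtain ⟨y0, y1⟩ := y
  obtain ⟨z0, z1⟩ := z
  rcases zmod_cases i with rfl | rfl <;> rcases zmod_cases j with rfl | rfl <;>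
    simp [IsHomog] at hx hy <;> subst hx hy <;>
    rcases Nat.mod_two_eq_zero_or_one I.card with hI | hI <;>
    rcases Nat.mod_two_eq_zero_or_one J.card with hJ | hJ <;>
    rcases Nat.mod_two_eq_zero_or_one L.card with hL | hL <;>
    simp [hComp, ssign, hI, hJ, hL, hIJ, hIL, hJL, Nat.add_mod, z00l h, z00r h, z01l h, z01r h,
      z10l h, z10r h, z11l h, z11r h,
      ← h.jac000, ← h.jac001, ← h.jac010, ← h.jac011, ← h.jac100, ← h.jac101, ← h.jac110,
      ← h.jac111] <;> rfl

lemma sum_assoc {M : Type*} [AddCommMonoid M] (S : Finset ℕ)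
    (F : Finset ℕ → Finset ℕ → Finset ℕ → M) :
    ∑ U ∈ S.powerset, ∑ I ∈ U.powerset, F I (U \ I) (S \ U) =
      ∑ I ∈ S.powerset, ∑ J ∈ (S \ I).powerset, F I J ((S \ I) \ J) := by
  rw [Finset.sum_sigma', Finset.sum_sigma']
  refine Finset.sum_bij' (fun a _ => ⟨a.2, a.1 \ a.2⟩) (fun a _ => ⟨a.1 ∪ a.2, a.1⟩) ?_ ?_ ?_ ?_ ?_
  · rintro ⟨U, I⟩ ha
    simp only [Finset.mem_sigma, Finset.mem_powerset] at ha ⊢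
    exact ⟨ha.2.trans ha.1, Finset.sdiff_subset_sdiff ha.1 le_rfl⟩
  · rintro ⟨I, J⟩ ha
    simp only [Finset.mem_sigma, Finset.mem_powerset] at ha ⊢
    exact ⟨Finset.union_subset ha.1 (ha.2.trans Finset.sdiff_subset), Finset.subset_union_left⟩
  · rintro ⟨U, I⟩ ha
    simp only [Finset.mem_sigma, Finset.mem_powerset] at ha
    simp [Finset.union_sdiff_of_subset ha.2]
  · rintro ⟨I, J⟩ ha
    simp only [Finset.mem_sigma, Finset.mem_powerset] at ha
    have : (I ∪ J) \ I = J := by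
      rw [Finset.union_sdiff_left]
      exact Finset.sdiff_eq_self_of_disjoint (Finset.disjoint_of_subset_left ha.2 Finset.sdiff_disjoint)
    simp [this]
  · rintro ⟨U, I⟩ ha
    simp only [Finset.mem_sigma, Finset.mem_powerset] at ha
    have : (S \ I) \ (U \ I) = S \ U := by
      ext a; have := @ha.2 a; simp; tauto
    simp [this]

lemma sum_swap {M : Type*} [AddCommMonoid M] (S : Finset ℕ)
    (F : Finset ℕ → Finset ℕ → Finset ℕ → M) :
    ∑ I ∈ S.powerset, ∑ J ∈ (S \ I).powerset, F J I ((S \ I) \ J) =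
      ∑ I ∈ S.powerset, ∑ J ∈ (S \ I).powerset, F I J ((S \ I) \ J) := by
  have key : ∀ I J : Finset ℕ, I ⊆ S ∧ J ⊆ S \ I → J ⊆ S ∧ I ⊆ S \ J := by
    rintro I J ⟨h1, h2⟩
    refine ⟨h2.trans Finset.sdiff_subset, fun a ha => ?_⟩
    have := @h2 a
    have := h1 ha
    simp_all
  rw [Finset.sum_sigma', Finset.sum_sigma']
  refine Finset.sum_bij' (fun a _ => ⟨a.2, a.1⟩) (fun a _ => ⟨a.2, a.1⟩) ?_ ?_ ?_ ?_ ?_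
  · rintro ⟨U, I⟩ ha
    simp only [Finset.mem_sigma, Finset.mem_powerset] at ha ⊢
    exact key _ _ ha
  · rintro ⟨U, I⟩ ha
    simp only [Finset.mem_sigma, Finset.mem_powerset] at ha ⊢
    exact key _ _ ha
  · rintro ⟨U, I⟩ ha
    rfl
  · rintro ⟨U, I⟩ ha
    rfl
  · rintro ⟨U, I⟩ ha
    simp only [sdiff_right_comm]

end helpers

/-- For a Lie superalgebra `𝔤`, the parity-changed split infinite Takiff
superalgebra `𝔥 = π'(gr'(T'^∞(𝔤)))`, with all `d_i` even and bracket given by the rules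
(1)–(3), is a Lie superalgebra. -/
theorem parityChangedInfiniteTakiff_isLieSuperAlg (h : IsLieSuperAlg K b00 b01 b10 b11) :
    IsLieSuperOn K (hPar (K := K) (g0 := g0) (g1 := g1)) (hBr b00 b01 b10 b11) := by
  refine ⟨?_, ?_, ?_, ?_, ?_, ?_, ?_, ?_⟩
  · intro x x' y
    funext S
    simp only [hBr, Pi.add_apply, hComp_add_left h, Finset.sum_add_distrib]
  · intro c x y
    funext S
    simp only [hBr, Pi.smul_apply, hComp_smul_left h, Finset.smul_sum]
  · intro x y y'
    funext S
    simp only [hBr, Pi.add_apply, hComp_add_right h, Finset.sum_add_distrib]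
  · intro c x y
    funext S
    simp only [hBr, Pi.smul_apply, hComp_smul_right h, Finset.smul_sum]
  · rw [DirectSum.isInternal_submodule_iff_isCompl (i := 0) (j := 1) _ (by decide)
      (by ext i; simpa using zmod_cases i)]
    constructor
    · rw [Submodule.disjoint_def]
      intro f h0 h1
      rw [mem_hPar_zero] at h0
      rw [mem_hPar_one] at h1
      funext I
      exact Prod.ext (h1 I) (h0 I)
    · rw [codisjoint_iff, Submodule.eq_top_iff']
      intro f
      rw [Submodule.mem_sup]
      refine ⟨fun I => ((f I).1, 0), (mem_hPar_zero _).2 fun _ => rfl,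
        fun I => (0, (f I).2), (mem_hPar_one _).2 fun _ => rfl, ?_⟩
      funext I
      simp
  · intro i j x hx y hy
    rw [mem_hPar] at hx hy
    have hs : ∀ S I, IsHomog (i + j) (hComp b00 b01 b10 b11 I (S \ I) (x I) (y (S \ I))) :=
      fun S I => hComp_grade h i j _ _ _ _ (hx _) (hy _)
    rw [mem_hPar]
    intro S
    unfold IsHomog at hs ⊢
    split_ifs with hij
    · simp only [hij, if_true] at hs
      simp only [hBr, Prod.snd_sum]
      exact Finset.sum_eq_zero fun I _ => hs S I
    · simp only [hij, if_false] at hs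
      simp only [hBr, Prod.fst_sum]
      exact Finset.sum_eq_zero fun I _ => hs S I
  · intro i j x hx y hy
    rw [mem_hPar] at hx hy
    funext S
    simp only [hBr, Pi.smul_apply, Finset.smul_sum]
    refine Finset.sum_bij' (fun I _ => S \ I) (fun I _ => S \ I) ?_ ?_ ?_ ?_ ?_
    · intro I _; simp
    · intro I _; simp
    · intro I hI; simpa using hI
    · intro I hI; simpa using hI
    · intro I hI
      rw [Finset.sdiff_sdiff_eq_self (Finset.mem_powerset.1 hI)]
      exact hComp_skew h i j _ _ _ _ (hx _) (hy _)
  · intro i j x hx y hy z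
    rw [mem_hPar] at hx hy
    funext S
    simp only [hBr, Pi.smul_apply, Pi.sub_apply, hComp_sum_left h, hComp_sum_right h]
    have e1 := sum_assoc S (fun I J L => hComp b00 b01 b10 b11 (I ∪ J) L
      (hComp b00 b01 b10 b11 I J (x I) (y J)) (z L))
    have e2 := sum_swap S (fun I J L => hComp b00 b01 b10 b11 J (I ∪ L) (y J)
      (hComp b00 b01 b10 b11 I L (x I) (z L)))
    have e1' : ∑ U ∈ S.powerset, ∑ I ∈ U.powerset, hComp b00 b01 b10 b11 U (S \ U)
        (hComp b00 b01 b10 b11 I (U \ I) (x I) (y (U \ I))) (z (S \ U)) =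
        ∑ I ∈ S.powerset, ∑ J ∈ (S \ I).powerset, hComp b00 b01 b10 b11 (I ∪ J) ((S \ I) \ J)
          (hComp b00 b01 b10 b11 I J (x I) (y J)) (z ((S \ I) \ J)) := by
      refine Eq.trans (Finset.sum_congr rfl fun U _ => Finset.sum_congr rfl fun I hI => ?_) e1
      simp only [Finset.union_sdiff_of_subset (Finset.mem_powerset.1 hI)]
    have e2' : ∑ J ∈ S.powerset, ∑ I ∈ (S \ J).powerset, hComp b00 b01 b10 b11 J (S \ J) (y J)
        (hComp b00 b01 b10 b11 I ((S \ J) \ I) (x I) (z ((S \ J) \ I))) =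
        ∑ I ∈ S.powerset, ∑ J ∈ (S \ I).powerset,
          hComp b00 b01 b10 b11 J (I ∪ (S \ I) \ J) (y J)
            (hComp b00 b01 b10 b11 I ((S \ I) \ J) (x I) (z ((S \ I) \ J))) := by
      refine Eq.trans (Finset.sum_congr rfl fun U _ => Finset.sum_congr rfl fun I hI => ?_) e2
      simp only [Finset.union_sdiff_of_subset (Finset.mem_powerset.1 hI)]
    rw [e1', e2']
    simp only [Finset.smul_sum, ← Finset.sum_sub_distrib]
    refine Finset.sum_congr rfl fun I hI => Finset.sum_congr rfl fun J hJ => ?_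
    rw [Finset.mem_powerset] at hI hJ
    have dIJ : Disjoint I J := Finset.disjoint_of_subset_right hJ Finset.disjoint_sdiff
    have dIL : Disjoint I ((S \ I) \ J) :=
      Finset.disjoint_of_subset_right Finset.sdiff_subset Finset.disjoint_sdiff
    refine hComp_jacobi h i j _ _ _ _ _ _ (Finset.card_union_of_disjoint dIJ)
      (Finset.card_union_of_disjoint dIL) ?_ _ _ _ (hx _) (hy _)
    have := Finset.card_sdiff_add_card_eq_card hJ
    omega

end Stmt9
end
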